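/- Assume property (*). Let β ∈ S, let z ∈ G_β, and write z = Σ_{i=1}^{k} r_i·x_{α_i} + Σ_{j=1}^{g} s_j·y_{β_j} with r_i, s_j ∈ ℚ, α_i < β, and β_j ∈ S with β_j < β. Let l be a positive integer, ν < δ and n < ω, and suppose that p^n_ν > l and that l·y_β − z is divisible by p^n_ν in G. Then either for some 1 ≤ j ≤ g the set E_{β_j} has a ν-th member and it equals the ν-th member of E_β, or for some 1 ≤ i ≤ k the ν-th member of E_β belongs to F_{α_i}. -/

import Mathlib

open Cardinal Ordinal Set

noncomputable section

/-- The order type of a set of ordinals: the unique ordinal order-isomorphic to it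
under its natural ordering (it lives one universe up). -/
def otype (A : Set Ordinal.{0}) : Ordinal.{1} :=
  Ordinal.type ((· < ·) : A → A → Prop)

/-- `C` is a club (closed unbounded) subset of the ordinal `l`. -/
def IsClubIn (C : Set Ordinal.{0}) (l : Ordinal.{0}) : Prop :=
  C ⊆ Set.Iio l ∧ (∀ a < l, ∃ b ∈ C, a ≤ b) ∧
    ∀ s : Set Ordinal.{0}, s ⊆ C → s.Nonempty → sSup s < l → sSup s ∈ C

/-- `S` is a stationary subset of the ordinal `l`. -/
def IsStationaryIn (S : Set Ordinal.{0}) (l : Ordinal.{0}) : Prop :=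
  S ⊆ Set.Iio l ∧ ∀ C : Set Ordinal.{0}, IsClubIn C l → (S ∩ C).Nonempty

/-- `γ` is the `ν`-th member of the set of ordinals `A`. -/
def nthMem (A : Set Ordinal.{0}) (ν : Ordinal.{1}) (γ : Ordinal.{0}) : Prop :=
  γ ∈ A ∧ otype (A ∩ Set.Iio γ) = ν

/-- The ambient group: the direct sum `(⊕_{α} ℚ) ⊕ (⊕_{β} ℚ)`, realized as
finitely supported functions from `Ordinal ⊕ Ordinal` to `ℚ`. -/
abbrev Vg : Type 1 := (Ordinal.{0} ⊕ Ordinal.{0}) →₀ ℚ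

/-- The distinguished basis element `x_α`. -/
def xg (α : Ordinal.{0}) : Vg := Finsupp.single (Sum.inl α) 1

/-- The distinguished basis element `y_β`. -/
def yg (β : Ordinal.{0}) : Vg := Finsupp.single (Sum.inr β) 1

/-- `h` is divisible by the natural number `m` inside the subgroup `H`. -/
def divIn (H : AddSubgroup Vg) (m : ℕ) (h : Vg) : Prop :=
  ∃ w ∈ H, h = m • w

/-- The set-theoretic data of the Magidor–Shelah construction, together with
property (*). `lam = ℵ_{ω+1}` and `mu = ℵ_ω` (as ordinals). -/
structure StarSystem where
  /-- the family `⟨f_α : α < λ⟩` of functions `ω → μ` -/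
  f : Ordinal.{0} → ℕ → Ordinal.{0}
  /-- the stationary set `S ⊆ λ` -/
  S : Set Ordinal.{0}
  /-- the countable ordinal `δ` -/
  δ : Ordinal.{1}
  /-- the sets `C_β` cofinal in `β` for `β ∈ S` -/
  C : Ordinal.{0} → Set Ordinal.{0}
  /-- the injective assignment `(ν, n) ↦ p^n_ν` of primes -/
  p : Ordinal.{1} → ℕ → ℕ
  f_lt : ∀ α < (Cardinal.aleph (Ordinal.omega0 + 1)).ord, ∀ n : ℕ,
    f α n < (Cardinal.aleph Ordinal.omega0).ord
  S_sub : S ⊆ Set.Iio (Cardinal.aleph (Ordinal.omega0 + 1)).ord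
  S_stat : IsStationaryIn S (Cardinal.aleph (Ordinal.omega0 + 1)).ord
  S_cof : ∀ β ∈ S, Ordinal.cof β = Cardinal.aleph 1
  δ_countable : δ < (Cardinal.aleph 1).ord
  δ_indec : ∀ a < δ, ∀ b < δ, a + b < δ
  C_sub : ∀ β ∈ S, C β ⊆ Set.Iio β
  C_cofinal : ∀ β ∈ S, sSup (C β) = β
  C_type : ∀ β ∈ S, otype (C β) = (Cardinal.aleph 1).ord
  D_type : ∀ β ∈ S, ∀ D ⊆ C β, sSup D = β →
    otype (⋃ α ∈ D, Set.range (f α)) = δ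
  E_inter : ∀ β ∈ S, ∀ γ ∈ S, β ≠ γ →
    otype ((⋃ α ∈ C β, Set.range (f α)) ∩ (⋃ α ∈ C γ, Set.range (f α))) < δ
  p_prime : ∀ ν < δ, ∀ n : ℕ, (p ν n).Prime
  p_inj : ∀ ν < δ, ∀ ν' < δ, ∀ n n' : ℕ, p ν n = p ν' n' → ν = ν' ∧ n = n'

namespace StarSystem

variable (𝒮 : StarSystem)

/-- `E_β = ⋃_{α ∈ C_β} F_α`, where `F_α` is the range of `f_α`. -/
def E (β : Ordinal.{0}) : Set Ordinal.{0} := ⋃ α ∈ 𝒮.C β, Set.range (𝒮.f α)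

/-- The generators of the group `G`: all `x_α` (`α < λ`), all `y_β` (`β ∈ S`),
and the elements `(1/p^n_ν)(y_β − x_α)` for `β ∈ S`, `α ∈ C_β`, `ν < δ`, `n < ω`
with `f_α(n)` the `ν`-th member of `E_β`. -/
def gens : Set Vg :=
  {v | ∃ α < (Cardinal.aleph (Ordinal.omega0 + 1)).ord, v = xg α} ∪
  {v | ∃ β ∈ 𝒮.S, v = yg β} ∪
  {v | ∃ β ∈ 𝒮.S, ∃ α ∈ 𝒮.C β, ∃ ν < 𝒮.δ, ∃ n : ℕ,
      nthMem (𝒮.E β) ν (𝒮.f α n) ∧ v = ((𝒮.p ν n : ℚ))⁻¹ • (yg β - xg α)}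

/-- The group `G`. -/
def G : AddSubgroup Vg := AddSubgroup.closure 𝒮.gens

/-- The subgroup `G_γ`, generated by those generators of `G` whose indices are
below `γ`. -/
def Gsub (γ : Ordinal.{0}) : AddSubgroup Vg :=
  AddSubgroup.closure
    ({v | ∃ α < (Cardinal.aleph (Ordinal.omega0 + 1)).ord, α < γ ∧ v = xg α} ∪
     {v | ∃ η ∈ 𝒮.S, η < γ ∧ v = yg η} ∪
     {v | ∃ η ∈ 𝒮.S, η < γ ∧ ∃ α ∈ 𝒮.C η, α < γ ∧ ∃ ν < 𝒮.δ, ∃ n : ℕ,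
        nthMem (𝒮.E η) ν (𝒮.f α n) ∧ v = ((𝒮.p ν n : ℚ))⁻¹ • (yg η - xg α)})

end StarSystem

end

theorem otype_inter_Iio (A : Set Ordinal.{0}) (x : A) :
    otype (A ∩ Set.Iio x.1) = Ordinal.typein ((· < ·) : A → A → Prop) x := by
  unfold otype
  rw [← Ordinal.type_subrel]
  refine Ordinal.type_eq.2 ⟨⟨⟨fun t => ⟨⟨t.1, t.2.1⟩, t.2.2⟩, fun t => ⟨t.1.1, t.1.2, t.2⟩, ?_, ?_⟩, ?_⟩⟩
  · intro t; rfl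
  · intro t; rfl
  · intro s t; rfl

theorem nthMem_unique {A : Set Ordinal.{0}} {ν : Ordinal.{1}} {x y : Ordinal.{0}}
    (hx : nthMem A ν x) (hy : nthMem A ν y) : x = y := by
  have h1 := otype_inter_Iio A ⟨x, hx.1⟩
  have h2 := otype_inter_Iio A ⟨y, hy.1⟩
  have := (Ordinal.typein_injective ((· < ·) : A → A → Prop)) 
    (h1.symm.trans ((hx.2.trans hy.2.symm).trans h2))
  exact congrArg Subtype.val this

theorem nthMem_exists {A : Set Ordinal.{0}} {ν : Ordinal.{1}} (h : ν < otype A) :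
    ∃ x, nthMem A ν x := by
  obtain ⟨x, hx⟩ := Ordinal.typein_surj ((· < ·) : A → A → Prop) h
  exact ⟨x.1, x.2, (otype_inter_Iio A x).trans hx⟩

/-- **The main lemma (Lemma 5 of Magidor–Shelah).**
Assume (*).  Let `β ∈ S` and let `z ∈ G_β` with
`z = Σ_{i} r_i·x_{α_i} + Σ_{j} s_j·y_{β_j}` where `r_i, s_j ∈ ℚ`, `α_i < β` and
`β_j ∈ S`, `β_j < β`.  Let `l > 0`, `ν < δ`, `n < ω`, suppose `p^n_ν > l` and
`l·y_β − z` is divisible by `p^n_ν` in `G`.  Then either for some `j` the set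
`E_{β_j}` has a `ν`-th member equal to the `ν`-th member of `E_β`, or for some
`i` the `ν`-th member of `E_β` belongs to `F_{α_i}`. -/
theorem nu_th_member_of_divisible (𝒮 : StarSystem) (β : Ordinal.{0}) (hβ : β ∈ 𝒮.S)
    (k g : ℕ) (r : Fin k → ℚ) (a : Fin k → Ordinal.{0}) (ha : ∀ i, a i < β)
    (s : Fin g → ℚ) (b : Fin g → Ordinal.{0})
    (hbS : ∀ j, b j ∈ 𝒮.S) (hb : ∀ j, b j < β)
    (z : Vg) (hz : z ∈ 𝒮.Gsub β)
    (hzeq : z = (∑ i, r i • xg (a i)) + ∑ j, s j • yg (b j))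
    (l : ℕ) (hl : 0 < l) (ν : Ordinal.{1}) (hν : ν < 𝒮.δ) (n : ℕ)
    (hpl : l < 𝒮.p ν n)
    (hdiv : divIn 𝒮.G (𝒮.p ν n) (l • yg β - z)) :
    (∃ j : Fin g, ∃ γ : Ordinal.{0}, nthMem (𝒮.E β) ν γ ∧ nthMem (𝒮.E (b j)) ν γ) ∨
    (∃ i : Fin k, ∃ γ : Ordinal.{0}, nthMem (𝒮.E β) ν γ ∧ γ ∈ Set.range (𝒮.f (a i))) := by
  classical
  obtain ⟨γ, hγ⟩ : ∃ γ, nthMem (𝒮.E β) ν γ := by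
    apply nthMem_exists
    have := 𝒮.D_type β hβ (𝒮.C β) subset_rfl (𝒮.C_cofinal β hβ)
    unfold StarSystem.E
    rw [this]
    exact hν
  by_contra hcon
  push Not at hcon
  obtain ⟨hc1, hc2⟩ := hcon
  have hp := 𝒮.p_prime ν hν n
  have : Fact (𝒮.p ν n).Prime := ⟨hp⟩
  set p := 𝒮.p ν n with hpdef
  let φ : Vg →ₗ[ℚ] ℚ := Finsupp.linearCombination ℚ
    (Sum.elim (fun α => if 𝒮.f α n = γ then (1 : ℚ) else 0)
      (fun η => if nthMem (𝒮.E η) ν γ then (1 : ℚ) else 0))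
  have φx : ∀ α, φ (xg α) = if 𝒮.f α n = γ then (1 : ℚ) else 0 := by
    intro α; simp [φ, xg]
  have φy : ∀ η, φ (yg η) = if nthMem (𝒮.E η) ν γ then (1 : ℚ) else 0 := by
    intro η; simp [φ, yg]
  have key : ∀ w ∈ 𝒮.G, padicNorm p (φ w) ≤ 1 := by
    intro w hw
    unfold StarSystem.G at hw
    induction hw using AddSubgroup.closure_induction with
    | zero => simp
    | add u v _ _ hu hv =>
      rw [map_add]
      exact padicNorm.nonarchimedean.trans (max_le hu hv)
    | neg u _ hu => rw [map_neg, padicNorm.neg]; exact hu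
    | mem v hv =>
      rcases hv with (⟨α, _, rfl⟩ | ⟨η, _, rfl⟩) | ⟨η, _, α, _, ν', hν', n', hnth, rfl⟩
      · rw [φx]; split_ifs <;> simp
      · rw [φy]; split_ifs <;> simp
      · rw [map_smul, map_sub, φx, φy, _root_.smul_eq_mul]
        by_cases hpp : 𝒮.p ν' n' = p
        · obtain ⟨rfl, rfl⟩ := 𝒮.p_inj ν' hν' ν hν n' n hpp
          have : nthMem (𝒮.E η) ν' γ ↔ 𝒮.f α n' = γ :=
            ⟨fun h => nthMem_unique hnth h, fun h => h ▸ hnth⟩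
          simp [this]
        · rw [padicNorm.mul]
          have h1 : padicNorm p ((𝒮.p ν' n' : ℚ)⁻¹) = 1 := by
            have h3 : padicNorm p (𝒮.p ν' n' : ℚ) = 1 := by
              rw [padicNorm.nat_eq_one_iff]
              intro hd
              exact hpp ((Nat.prime_dvd_prime_iff_eq hp (𝒮.p_prime ν' hν' n')).1 hd).symm
            have h4 := padicNorm.mul (p := p) (𝒮.p ν' n' : ℚ) ((𝒮.p ν' n' : ℚ)⁻¹)
            rw [mul_inv_cancel₀ (by exact_mod_cast (𝒮.p_prime ν' hν' n').ne_zero), h3,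
              padicNorm.one, one_mul] at h4
            exact h4.symm
          rw [h1, one_mul]
          split_ifs <;> simp
  obtain ⟨w, hw, hwe⟩ := hdiv
  have hφ := congrArg φ hwe
  have hz0 : φ z = 0 := by
    rw [hzeq, map_add, map_sum, map_sum]
    rw [Finset.sum_eq_zero, Finset.sum_eq_zero, add_zero]
    · intro j _
      rw [map_smul, φy, if_neg (hc1 j γ hγ), smul_zero]
    · intro i _
      rw [map_smul, φx, if_neg (fun h => hc2 i γ hγ ⟨n, h⟩), smul_zero]
  rw [map_sub, hz0, map_nsmul, map_nsmul, φy, if_pos hγ, _root_.sub_zero, _root_.nsmul_eq_mul, _root_.nsmul_eq_mul,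
    mul_one] at hφ
  have h1 : padicNorm p (l : ℚ) = 1 := by
    rw [padicNorm.nat_eq_one_iff]
    exact Nat.not_dvd_of_pos_of_lt hl hpl
  rw [hφ, padicNorm.mul] at h1
  have h2 := key w hw
  have h3 : padicNorm p (p : ℚ) < 1 := padicNorm.padicNorm_p_lt_one_of_prime
  have h4 : 0 ≤ padicNorm p (p : ℚ) := padicNorm.nonneg _
  nlinarith
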